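/- Let G be a simple graph with vertex set V, let k ≥ 2, and let {S_1, ..., S_k} be a partition of V into k nonempty parts. For each i define the vector s^(i) indexed by V with entry −k+1 at vertices of S_i and entry 1 at all other vertices. If s^(i) is an eigenvector of the Laplacian L(G) = D(G) − A(G) to the eigenvalue μ for every i ∈ {1,...,k}, then the spanning subgraph of G whose edge set is the union over all pairs i ≠ j of the edges between S_i and S_j is (μ(k−1)/k)-regular; that is, for every i and every vertex v ∈ S_i, the sum over j ≠ i of d_v(S_i,S_j) equals μ(k−1)/k. -/

import Mathlib

open Finset

/-- Number of neighbors of `v` (in graph `G`) lying in the set `X`. -/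
def degIn {n : ℕ} (G : SimpleGraph (Fin n)) [DecidableRel G.Adj]
    (v : Fin n) (X : Finset (Fin n)) : ℕ :=
  (X.filter fun u => G.Adj v u).card

/-- The Laplacian matrix `L(G) = D(G) - A(G)`. -/
def lap {n : ℕ} (G : SimpleGraph (Fin n)) [DecidableRel G.Adj] :
    Matrix (Fin n) (Fin n) ℝ :=
  Matrix.diagonal (fun v => (G.degree v : ℝ)) - G.adjMatrix ℝ

theorem lap_mulVec_apply {n : ℕ} (G : SimpleGraph (Fin n)) [DecidableRel G.Adj]
    (f : Fin n → ℝ) (v : Fin n) :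
    (lap G).mulVec f v = G.degree v * f v - ∑ u ∈ G.neighborFinset v, f u := by
  rw [lap, Matrix.sub_mulVec, Pi.sub_apply, Matrix.mulVec_diagonal,
    SimpleGraph.adjMatrix_mulVec_apply]

theorem degIn_eq_card_filter_neighborFinset {n : ℕ} (G : SimpleGraph (Fin n))
    [DecidableRel G.Adj] (v : Fin n) (X : Finset (Fin n)) :
    degIn G v X = ((G.neighborFinset v).filter (· ∈ X)).card := by
  rw [degIn]
  congr 1
  ext u
  simp [and_comm]

/-- The numbers of neighbors of `v` in the parts of a partition add up to the degree of `v`. -/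
theorem sum_degIn_eq_degree {n k : ℕ} (G : SimpleGraph (Fin n)) [DecidableRel G.Adj]
    (S : Fin k → Finset (Fin n)) (hdisj : ∀ i j, i ≠ j → Disjoint (S i) (S j))
    (hcover : ∀ v, ∃ i, v ∈ S i) (v : Fin n) :
    ∑ j, degIn G v (S j) = G.degree v := by
  simp only [degIn]
  rw [← card_biUnion fun i _ j _ hij => disjoint_filter_filter (hdisj i j hij),
    ← G.card_neighborFinset_eq_degree]
  congr 1
  ext u
  simpa using fun _ => hcover u

theorem stmt_16 {n k : ℕ} (hk : 2 ≤ k) (G : SimpleGraph (Fin n)) [DecidableRel G.Adj]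
    (S : Fin k → Finset (Fin n))
    (hdisj : ∀ i j, i ≠ j → Disjoint (S i) (S j))
    (hcover : ∀ v, ∃ i, v ∈ S i)
    (hne : ∀ i, (S i).Nonempty)
    (s : Fin k → Fin n → ℝ)
    (hs : ∀ i v, s i v = if v ∈ S i then -(k : ℝ) + 1 else 1)
    (mu : ℝ)
    (heig : ∀ i, s i ≠ 0 ∧ (lap G).mulVec (s i) = mu • s i) :
    ∀ i, ∀ v ∈ S i,
      (∑ j ∈ Finset.univ.erase i, (degIn G v (S j) : ℝ)) = mu * ((k : ℝ) - 1) / k := by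
  intro i v hv
  have hk0 : (k : ℝ) ≠ 0 := by positivity
  have hsum : ∑ u ∈ G.neighborFinset v, s i u = G.degree v - k * degIn G v (S i) := by
    have hsu : ∀ u, s i u = 1 - k * if u ∈ S i then 1 else 0 := fun u => by
      rw [hs]; split_ifs <;> ring
    simp_rw [hsu, sum_sub_distrib, ← mul_sum, sum_boole,
      ← degIn_eq_card_filter_neighborFinset]
    simp
  have hv_eig := congrFun (heig i).2 v
  rw [lap_mulVec_apply, hsum, Pi.smul_apply, smul_eq_mul, hs, if_pos hv] at hv_eig
  have hdeg : ∑ j, (degIn G v (S j) : ℝ) = G.degree v :=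
    mod_cast sum_degIn_eq_degree G S hdisj hcover v
  rw [← add_sum_erase _ _ (mem_univ i)] at hdeg
  rw [eq_div_iff hk0]
  linear_combination k * hdeg - hv_eig
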